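/- Let R be a Lie conformal algebra and let φ be a conformal biderivation of R. Then for all x, y, u, v ∈ R and all formal variables λ, μ, γ, the identity [(φ_μ(x,y))_{μ+γ} [u_λ v]] = [[x_μ y]_{μ+γ} φ_λ(u,v)] holds. -/

import Mathlib

/- Framework: a Lie conformal algebra over ℂ is a ℂ[∂]-module `R` (given by a ℂ-module
with a ℂ-linear operator `D` for the action of `∂`) with a λ-bracket `B : R → R → R[λ]`.
We model `R[λ]` as `ℕ →₀ R` (coefficient of `λ^n` at index `n`) and `R[λ,μ,γ]` as an
iterated Finsupp.  Substitutions of the bracket variable are implemented by evaluating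
the polynomial at a commuting operator (e.g. multiplication by `λ`, by `λ+μ`, or by
`-∂-λ`), and brackets/biderivations are extended to polynomial-valued arguments by
ℂ[λ,μ,γ]-bilinearity. -/

namespace ConfBider

variable {R : Type} [AddCommGroup R] [Module ℂ R]

/-- `R[λ]`. -/
abbrev Pol1 (R : Type) [AddCommGroup R] : Type := ℕ →₀ R

/-- `R[λ,μ,γ]`: index `a` is the exponent of `λ`, then `μ`, then `γ`. -/
abbrev Pol3 (R : Type) [AddCommGroup R] : Type := ℕ →₀ (ℕ →₀ (ℕ →₀ R))

/-- Multiplication by the variable on `R[λ]`. -/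
noncomputable def shift1 : Pol1 R → Pol1 R := Finsupp.mapDomain (· + 1)

/-- The action of `∂` on coefficients of `R[λ]`. -/
noncomputable def D1 (D : R →ₗ[ℂ] R) : Pol1 R → Pol1 R := Finsupp.mapRange D (map_zero D)

/-- The operator "multiplication by `-∂-λ`" on `R[λ]`. -/
noncomputable def subNeg (D : R →ₗ[ℂ] R) : Pol1 R → Pol1 R := fun z => -(D1 D z) - shift1 z

/-- Evaluation of `f ∈ R[ν]` at the operator `e` (substitution `ν ↦ e`), inside `R[λ]`. -/
noncomputable def ev1 (f : Pol1 R) (e : Pol1 R → Pol1 R) : Pol1 R :=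
  f.sum fun n r => e^[n] (Finsupp.single 0 r)

/-- Constants `R → R[λ,μ,γ]`. -/
noncomputable def iota3 : R → Pol3 R := fun r => Finsupp.single 0 (Finsupp.single 0 (Finsupp.single 0 r))

/-- Multiplication by `λ` on `R[λ,μ,γ]`. -/
noncomputable def Xl : Pol3 R → Pol3 R := Finsupp.mapDomain (· + 1)

/-- Multiplication by `μ` on `R[λ,μ,γ]`. -/
noncomputable def Xm : Pol3 R → Pol3 R :=
  Finsupp.mapRange (Finsupp.mapDomain (· + 1)) Finsupp.mapDomain_zero

/-- Multiplication by `γ` on `R[λ,μ,γ]`. -/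
noncomputable def Xg : Pol3 R → Pol3 R :=
  Finsupp.mapRange (Finsupp.mapRange (Finsupp.mapDomain (· + 1)) Finsupp.mapDomain_zero)
    Finsupp.mapRange_zero

/-- Multiplication by `λ+μ` on `R[λ,μ,γ]`. -/
noncomputable def eLM : Pol3 R → Pol3 R := fun z => Xl z + Xm z

/-- Multiplication by `μ+γ` on `R[λ,μ,γ]`. -/
noncomputable def eMG : Pol3 R → Pol3 R := fun z => Xm z + Xg z

/-- Evaluation of `f ∈ R[ν]` at the operator `e` (substitution `ν ↦ e`), in `R[λ,μ,γ]`. -/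
noncomputable def ev (f : Pol1 R) (e : Pol3 R → Pol3 R) : Pol3 R := f.sum fun n r => e^[n] (iota3 r)

/-- Extension of an `R`-argument operation `F` to a polynomial argument in `R[λ,μ,γ]`,
by ℂ[λ,μ,γ]-linearity. -/
noncomputable def lift3 (F : R → Pol3 R) : Pol3 R → Pol3 R := fun w =>
  w.sum fun a fa => fa.sum fun b fb => fb.sum fun c r => Xl^[a] (Xm^[b] (Xg^[c] (F r)))

/-- `φ : R × R → R[λ]` is a conformal bilinear map: ℂ-bilinear with
`φ_λ(∂x,y) = -λ φ_λ(x,y)` and `φ_λ(x,∂y) = (∂+λ) φ_λ(x,y)`. -/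
structure IsConfBilinear (D : R →ₗ[ℂ] R) (φ : R → R → Pol1 R) : Prop where
  add_left : ∀ x x' y, φ (x + x') y = φ x y + φ x' y
  add_right : ∀ x y y', φ x (y + y') = φ x y + φ x y'
  smul_left : ∀ (c : ℂ) x y, φ (c • x) y = c • φ x y
  smul_right : ∀ (c : ℂ) x y, φ x (c • y) = c • φ x y
  d_left : ∀ x y, φ (D x) y = -(shift1 (φ x y))
  d_right : ∀ x y, φ x (D y) = D1 D (φ x y) + shift1 (φ x y)

/-- Skew-symmetry `φ_λ(x,y) = -φ_{-∂-λ}(y,x)`. -/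
noncomputable def IsSkew (D : R →ₗ[ℂ] R) (φ : R → R → Pol1 R) : Prop :=
  ∀ x y, φ x y = -(ev1 (φ y x) (subNeg D))

/-- A Lie conformal algebra structure: conformal sesquilinearity, skew-symmetry and
the Jacobi identity `[x_λ[y_μ z]] = [[x_λ y]_{λ+μ} z] + [y_μ[x_λ z]]`. -/
structure IsLieConformal (D : R →ₗ[ℂ] R) (B : R → R → Pol1 R) : Prop where
  bilin : IsConfBilinear D B
  skew : IsSkew D B
  jacobi : ∀ x y z,
    lift3 (fun r => ev (B x r) Xl) (ev (B y z) Xm)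
      = lift3 (fun r => ev (B r z) eLM) (ev (B x y) Xl)
        + lift3 (fun r => ev (B y r) Xm) (ev (B x z) Xl)

/-- A conformal biderivation of a Lie conformal algebra `(R, D, B)`: a skew-symmetric
conformal bilinear map `φ` with `φ_λ(x,[y_μ z]) = [(φ_λ(x,y))_{λ+μ} z] + [y_μ φ_λ(x,z)]`. -/
structure IsConfBiderivation (D : R →ₗ[ℂ] R) (B : R → R → Pol1 R)
    (φ : R → R → Pol1 R) : Prop where
  bilin : IsConfBilinear D φ
  skew : IsSkew D φ
  leibniz : ∀ x y z,
    lift3 (fun r => ev (φ x r) Xl) (ev (B y z) Xm)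
      = lift3 (fun r => ev (B r z) eLM) (ev (φ x y) Xl)
        + lift3 (fun r => ev (B y r) Xm) (ev (φ x z) Xl)

section Evaluation

variable {A N : Type} [CommRing A] [AddCommGroup N] [Module A N]

/-- `evalHom a f ι = ∑ aⁿ • ι fₙ`: the evaluation of `f ∈ R[ν]` at `a`, with coefficients pushed
forward along `ι`. -/
noncomputable def evalHom (a : A) : Pol1 R →+ (R →+ N) →+ N :=
  Finsupp.liftAddHom fun n =>
    AddMonoidHom.mk' (fun r => AddMonoidHom.mk' (fun ι => a ^ n • ι r) (by simp))
      (by intro r s; ext ι; simp)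

omit [Module ℂ R] in
@[simp] lemma evalHom_single (a : A) (n : ℕ) (r : R) (ι : R →+ N) :
    evalHom a (Finsupp.single n r) ι = a ^ n • ι r := by
  simp [evalHom]

omit [Module ℂ R] in
lemma evalHom_apply (a : A) (f : Pol1 R) (ι : R →+ N) :
    evalHom a f ι = f.sum fun n r => a ^ n • ι r := by
  induction f using Finsupp.induction_linear with
  | zero => simp
  | add f g hf hg =>
    rw [Finsupp.sum_add_index' (by simp) (by simp), map_add, AddMonoidHom.add_apply, hf, hg]
  | single n r => simp

/-- The pushforward of a bilinear `F : R × R → R[ν]` along evaluation at `ν = a`. -/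
noncomputable def evalBilin (F : R →+ R →+ Pol1 R) (ι : R →+ N) (a : A) : R →+ R →+ N :=
  AddMonoidHom.mk' (fun r => ((evalHom a).flip ι).comp (F r)) (by intro r s; ext t; simp)

omit [Module ℂ R] in
@[simp] lemma evalBilin_apply (F : R →+ R →+ Pol1 R) (ι : R →+ N) (a : A) (r s : R) :
    evalBilin F ι a r s = evalHom a (F r s) ι := rfl

/-- `evalBilin F ι a` as a function of its first argument. -/
noncomputable abbrev evalBilinLeft (F : R →+ R →+ Pol1 R) (ι : R →+ N) (a : A) (s : R) : R →+ N :=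
  (evalBilin F ι a).flip s

omit [Module ℂ R] in
lemma evalHom_comp_swap (a c : A) (f g : Pol1 R) (K : R →+ R →+ N) :
    evalHom a f ((evalHom c g).comp K) = evalHom c g ((evalHom a f).comp K.flip) := by
  induction f using Finsupp.induction_linear with
  | zero => simp [AddMonoidHom.zero_comp]
  | add f f' hf hf' => simp only [map_add, AddMonoidHom.add_apply, AddMonoidHom.add_comp, hf, hf']
  | single n r =>
    induction g using Finsupp.induction_linear with
    | zero => simp [AddMonoidHom.zero_comp]
    | add g g' hg hg' =>
      simp only [map_add, AddMonoidHom.add_apply, AddMonoidHom.add_comp, hg, hg']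
    | single m s => simp [smul_comm (a ^ n) (c ^ m)]

omit [Module ℂ R] in
lemma evalHom_shift1 (a : A) (f : Pol1 R) (ι : R →+ N) :
    evalHom a (shift1 f) ι = a • evalHom a f ι := by
  unfold shift1
  induction f using Finsupp.induction_linear with
  | zero => simp
  | add f g hf hg =>
    simp only [Finsupp.mapDomain_add, map_add, AddMonoidHom.add_apply, hf, hg, smul_add]
  | single n r => simp [Finsupp.mapDomain_single, pow_succ', mul_smul]

omit [Module ℂ R] in
lemma evalHom_mapRange (a c : A) {g : R → R} (h₀ : g 0 = 0) {κ : R →+ N}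
    (hg : ∀ r, κ (g r) = c • κ r) (f : Pol1 R) :
    evalHom a (Finsupp.mapRange g h₀ f) κ = c • evalHom a f κ := by
  rw [evalHom_apply, evalHom_apply, Finsupp.sum_mapRange_index (by simp), Finsupp.smul_sum]
  exact Finsupp.sum_congr fun n _ => by rw [hg, smul_comm]

omit [Module ℂ R] in
lemma evalHom_smul_right (a c : A) (f : Pol1 R) (ι : R →+ N) :
    evalHom a f ((DistribSMul.toAddMonoidHom N c).comp ι) = c • evalHom a f ι := by
  rw [evalHom_apply, evalHom_apply, Finsupp.smul_sum]
  exact Finsupp.sum_congr fun n _ => by simp [smul_comm (a ^ n)]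

/-- `ι` intertwines `∂` with multiplication by `d`. -/
def Intertwines (D : R →ₗ[ℂ] R) (ι : R →+ N) (d : A) : Prop := ∀ r, ι (D r) = d • ι r

variable {D : R →ₗ[ℂ] R} {ι : R →+ N} {d : A}

lemma evalHom_D1 (hι : Intertwines D ι d) (a : A) (f : Pol1 R) :
    evalHom a (D1 D f) ι = d • evalHom a f ι :=
  evalHom_mapRange a d _ hι f

lemma evalHom_ev1_subNeg (hι : Intertwines D ι d) (a : A) (f : Pol1 R) :
    evalHom a (ev1 f (subNeg D)) ι = evalHom (-d - a) f ι := by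
  have key : ∀ (n : ℕ) (z : Pol1 R),
      evalHom a ((subNeg D)^[n] z) ι = (-d - a) ^ n • evalHom a z ι := by
    intro n
    induction n with
    | zero => simp
    | succ n ih =>
      intro z
      rw [Function.iterate_succ_apply, ih, pow_succ, mul_smul]
      congr 1
      simp only [subNeg, map_sub, map_neg, AddMonoidHom.sub_apply, AddMonoidHom.neg_apply,
        evalHom_D1 hι, evalHom_shift1, sub_smul, neg_smul]
  rw [evalHom_apply (-d - a), ev1, Finsupp.sum, map_sum, AddMonoidHom.finsetSum_apply]
  refine Finset.sum_congr rfl fun n _ => ?_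
  rw [key, evalHom_single, pow_zero, one_smul]

/-- Pushed-forward form of conformal sesquilinearity. -/
lemma Intertwines.evalBilin_right {F : R →+ R →+ Pol1 R}
    (hF : IsConfBilinear D fun x y => F x y) (hι : Intertwines D ι d) (a : A) (x : R) :
    Intertwines D (evalBilin F ι a x) (d + a) := by
  intro r
  have h : F x (D r) = _ := hF.d_right x r
  simp only [evalBilin_apply, h, map_add, AddMonoidHom.add_apply, evalHom_D1 hι, evalHom_shift1,
    add_smul]

lemma intertwines_evalBilin_left {F : R →+ R →+ Pol1 R}
    (hF : IsConfBilinear D fun x y => F x y) (ι : R →+ N) (a : A) (y : R) :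
    Intertwines D ((evalBilin F ι a).flip y) (-a) := by
  intro r
  have h : F (D r) y = _ := hF.d_left r y
  simp only [AddMonoidHom.flip_apply, evalBilin_apply, h, map_neg, AddMonoidHom.neg_apply,
    evalHom_shift1, neg_smul]

lemma intertwines_comp_evalBilin {F : R →+ R →+ Pol1 R}
    (hF : IsConfBilinear D fun x y => F x y) (ι : R →+ N) (a c : A) (g : Pol1 R) :
    Intertwines D ((evalHom c g).comp (evalBilin F ι a)) (-a) := by
  intro r
  have h : evalBilin F ι a (D r) = (DistribSMul.toAddMonoidHom N (-a)).comp (evalBilin F ι a r) := by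
    ext s
    exact intertwines_evalBilin_left hF ι a s r
  rw [AddMonoidHom.comp_apply, h, evalHom_smul_right, AddMonoidHom.comp_apply]

/-- Pushed-forward form of skew-symmetry. -/
lemma evalHom_skew {F : R →+ R →+ Pol1 R} (hF : IsSkew D fun x y => F x y)
    (hι : Intertwines D ι d) {a b : A} (hab : a + b = -d) (x y : R) :
    evalHom a (F x y) ι = -evalHom b (F y x) ι := by
  have h : F x y = _ := hF x y
  rw [h, map_neg, AddMonoidHom.neg_apply, evalHom_ev1_subNeg hι, ← hab, add_sub_cancel_left]

/-- `F` acts by derivations of `B` in its second argument, after every evaluation. -/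
def EvalLeibniz (A N : Type) [CommRing A] [AddCommGroup N] [Module A N]
    (B F : R →+ R →+ Pol1 R) : Prop :=
  ∀ (ι : R →+ N) (a b c : A), c = a + b → ∀ x y z : R,
    evalHom b (B y z) (evalBilin F ι a x) =
      evalHom a (F x y) ((evalBilin B ι c).flip z) + evalHom a (F x z) (evalBilin B ι b y)

variable {B φ : R →+ R →+ Pol1 R}

/-- The derivation property in the first argument. -/
lemma evalLeibniz_left (hB : IsConfBilinear D fun x y => B x y)
    (hφs : IsSkew D fun x y => φ x y) (hφ : EvalLeibniz A N B φ)
    (hι : Intertwines D ι d) {a b c w w' : A} (h : a + b + c = -d) (hw : w = a + b)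
    (hw' : w' = a + c) (x u y : R) :
    evalHom a (B x u) ((evalBilin φ ι w).flip y) =
      evalHom a (φ x y) ((evalBilin B ι w').flip u) + evalHom b (φ u y) (evalBilin B ι a x) := by
  have h₁ : (evalBilin φ ι w).flip y = -evalBilin φ ι c y := by
    ext r
    exact evalHom_skew hφs hι (by rw [hw, h]) r y
  rw [h₁, map_neg, hφ ι c a w' (by rw [hw', add_comm]) y x u,
    evalHom_skew hφs (intertwines_evalBilin_left hB ι w' u) (a := a) (b := c)
      (by rw [hw', neg_neg]) x y,
    evalHom_skew hφs (hι.evalBilin_right hB a x) (a := b) (b := c)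
      (by linear_combination h) u y]
  abel

/-- `[φ(x,y),[u,v]] - [[x,y],φ(u,v)]`, where `x`, `y`, `u` carry the weights `a`, `b`, `c`. -/
noncomputable def defect (B φ : R →+ R →+ Pol1 R) (ι : R →+ N) (v : R) (x : R) (a : A) (y : R)
    (b : A) (u : R) (c : A) : N :=
  evalHom a (φ x y) ((evalHom c (B u v)).comp (evalBilin B ι (a + b))) -
    evalHom a (B x y) ((evalHom c (φ u v)).comp (evalBilin B ι (a + b)))

lemma defect_antisymm (hB : IsConfBilinear D fun x y => B x y) (hBs : IsSkew D fun x y => B x y)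
    (hφs : IsSkew D fun x y => φ x y) (ι : R →+ N) (v x : R) (a : A) (y : R) (b : A)
    (u : R) (c : A) :
    defect B φ ι v x a y b u c = -defect B φ ι v y b x a u c := by
  unfold defect
  rw [evalHom_skew hφs (intertwines_comp_evalBilin hB ι (a + b) c _) (a := a) (b := b) (by simp),
    evalHom_skew hBs (intertwines_comp_evalBilin hB ι (a + b) c _) (a := a) (b := b) (by simp),
    add_comm b a]
  abel

/-- Comparing both expansions of `φ([x,u],[y,v])`. -/
lemma defect_symm (hB : IsConfBilinear D fun x y => B x y) (hBs : IsSkew D fun x y => B x y)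
    (hφs : IsSkew D fun x y => φ x y) (hBl : EvalLeibniz A N B B) (hφ : EvalLeibniz A N B φ)
    (hι : Intertwines D ι d) (v x : R) (a : A) (y : R) (b : A) (u : R) (c : A) :
    defect B φ ι v x a y b u c = defect B φ ι v u c y b x a := by
  obtain ⟨e, he⟩ : ∃ e : A, a + b + c + e = -d := ⟨-d - (a + b + c), by ring⟩
  have second : evalHom a (B x u) ((evalHom b (B y v)).comp (evalBilin φ ι (a + c))) =
      (evalHom a (φ x y) ((evalBilin B ((evalBilin B ι (a + b + c)).flip v) (a + b)).flip u) +
        evalHom c (φ u y) (evalBilin B ((evalBilin B ι (a + b + c)).flip v) a x)) +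
      (evalHom a (φ x v) ((evalBilin B (evalBilin B ι b y) (a + e)).flip u) +
        evalHom c (φ u v) (evalBilin B (evalBilin B ι b y) a x)) := by
    have h : (evalHom b (B y v)).comp (evalBilin φ ι (a + c)) =
        (evalBilin φ ((evalBilin B ι (a + b + c)).flip v) (a + c)).flip y +
          (evalBilin φ (evalBilin B ι b y) (a + c)).flip v := by
      ext r
      exact hφ ι (a + c) b (a + b + c) (by ring) r y v
    rw [h, map_add,
      evalLeibniz_left hB hφs hφ (intertwines_evalBilin_left hB ι (a + b + c) v)
        (b := c) (c := b) (w' := a + b) (by ring) rfl rfl,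
      evalLeibniz_left hB hφs hφ (hι.evalBilin_right hB b y)
        (b := c) (c := e) (w' := a + e) (by linear_combination he) rfl rfl]
  have first : evalHom a (B x u) ((evalHom b (B y v)).comp (evalBilin φ ι (a + c))) =
      (evalHom a (φ x y) ((evalBilin B ((evalBilin B ι (a + b + e)).flip u) (a + b)).flip v) +
        evalHom a (φ x v) (evalBilin B ((evalBilin B ι (a + b + e)).flip u) b y)) +
      (evalHom c (φ u y) ((evalBilin B (evalBilin B ι a x) (c + b)).flip v) +
        evalHom c (φ u v) (evalBilin B (evalBilin B ι a x) b y)) := by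
    have h : (evalHom a (B x u)).comp (evalBilin φ ι (a + c)).flip =
        evalBilin φ ((evalBilin B ι (a + b + e)).flip u) a x +
          evalBilin φ (evalBilin B ι a x) c u := by
      ext s
      exact evalLeibniz_left hB hφs hφ hι (c := b + e) (by linear_combination he) rfl (by ring)
        x u s
    rw [evalHom_comp_swap, h, map_add, hφ _ a b (a + b) rfl, hφ _ c b (c + b) rfl]
  have hxy : (evalBilin B ((evalBilin B ι (a + b + c)).flip v) (a + b)).flip u =
      (evalBilin B ((evalBilin B ι (a + b + e)).flip u) (a + b)).flip v +
        (evalHom c (B u v)).comp (evalBilin B ι (a + b)) := by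
    ext r
    have h₁ := hBl ι (a + b) c (a + b + c) rfl r u v
    have h₂ : evalBilin B ι c u = -(evalBilin B ι (a + b + e)).flip u := by
      ext s
      exact evalHom_skew hBs hι (by linear_combination he) u s
    rw [h₂, map_neg] at h₁
    simp only [AddMonoidHom.flip_apply, AddMonoidHom.add_apply, AddMonoidHom.comp_apply,
      evalBilin_apply, h₁]
    abel
  have huy : (evalBilin B (evalBilin B ι a x) (c + b)).flip v =
      evalBilin B ((evalBilin B ι (a + b + c)).flip v) a x +
        (evalHom a (B x v)).comp (evalBilin B ι (c + b)) := by
    ext r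
    exact hBl ι a (c + b) (a + b + c) (by ring) x r v
  have hxv : (evalBilin B (evalBilin B ι b y) (a + e)).flip u =
      evalBilin B ((evalBilin B ι (a + b + e)).flip u) b y +
        (evalHom c (B u y)).comp (evalBilin B ι (c + b)).flip := by
    ext r
    have h₁ := hBl ι b (a + e) (a + b + e) (by ring) y r u
    have h₂ : evalBilin B ι (a + e) r = -(evalBilin B ι (c + b)).flip r := by
      ext s
      exact evalHom_skew hBs hι (by linear_combination he) r s
    have h₃ := evalHom_skew hBs (intertwines_evalBilin_left hB ι (c + b) r) (a := b) (b := c)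
      (by ring) y u
    rw [h₂, map_neg, h₃, neg_neg] at h₁
    exact h₁
  have huv : evalBilin B (evalBilin B ι a x) b y =
      evalBilin B (evalBilin B ι b y) a x +
        (evalHom a (B x y)).comp (evalBilin B ι (a + b)).flip := by
    ext r
    have h₁ := hBl ι a b (a + b) rfl x y r
    exact h₁.trans (add_comm _ _)
  rw [first, hxy, huy, hxv, huv] at second
  simp only [map_add] at second
  unfold defect
  rw [evalHom_comp_swap a c (B x y), evalHom_comp_swap c a (B u y)]
  rw [← sub_eq_zero] at second ⊢
  rw [← neg_eq_zero, ← second]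
  abel

lemma defect_eq_zero (hN : ∀ z : N, z = -z → z = 0) (hB : IsConfBilinear D fun x y => B x y)
    (hBs : IsSkew D fun x y => B x y)
    (hφs : IsSkew D fun x y => φ x y) (hBl : EvalLeibniz A N B B) (hφ : EvalLeibniz A N B φ)
    (hι : Intertwines D ι d) (v x : R) (a : A) (y : R) (b : A) (u : R) (c : A) :
    defect B φ ι v x a y b u c = 0 := by
  apply hN
  have symm := defect_symm hB hBs hφs hBl hφ hι v
  have anti := defect_antisymm (A := A) hB hBs hφs ι v
  calc defect B φ ι v x a y b u c = defect B φ ι v u c y b x a := symm x a y b u c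
    _ = -defect B φ ι v x a y b u c := by
      rw [anti u c y b x a, symm y b u c x a, anti x a u c y b, neg_neg, symm u c x a y b,
        anti y b x a u c]

end Evaluation

section Polynomials

variable {A N : Type} [CommRing A] [AddCommGroup N] [Module A N]

omit [Module ℂ R] in
lemma map_evalHom {A' N' : Type} [CommRing A'] [AddCommGroup N'] [Module A' N'] (Ψ : N →+ N')
    {t : A} {t' : A'} (hΨ : ∀ z, Ψ (t • z) = t' • Ψ z) (f : Pol1 R) (ι : R →+ N) :
    Ψ (evalHom t f ι) = evalHom t' f (Ψ.comp ι) := by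
  have key : ∀ (n : ℕ) (z : N), Ψ (t ^ n • z) = t' ^ n • Ψ z := by
    intro n
    induction n with
    | zero => simp
    | succ n ih => intro z; rw [pow_succ', mul_smul, hΨ, ih, pow_succ', mul_smul]
  simp only [evalHom_apply, Finsupp.sum, map_sum, key, AddMonoidHom.comp_apply]

/-- Evaluation of `R[λ,μ,γ]` at `(a, b, c)`, with coefficients pushed forward along `ι`. -/
noncomputable def evalHom3 (a b c : A) (ι : R →+ N) : Pol3 R →+ N :=
  (evalHom (R := ℕ →₀ ℕ →₀ R) a).flip
    ((evalHom (R := ℕ →₀ R) b).flip ((evalHom (R := R) c).flip ι))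

variable (a b c : A) (ι : R →+ N)

omit [Module ℂ R] in
lemma evalHom3_iota3 (r : R) : evalHom3 a b c ι (iota3 r) = ι r := by
  simp [evalHom3, iota3]

omit [Module ℂ R] in
lemma evalHom3_Xl (z : Pol3 R) : evalHom3 a b c ι (Xl z) = a • evalHom3 a b c ι z :=
  evalHom_shift1 a z _

omit [Module ℂ R] in
lemma evalHom3_Xm (z : Pol3 R) : evalHom3 a b c ι (Xm z) = b • evalHom3 a b c ι z :=
  evalHom_mapRange a b _ (fun f => evalHom_shift1 b f _) z

open scoped IsMulCommutative in
lemma exists_commRing_of_commute {M I : Type} [AddCommGroup M] (e : I → M → M)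
    (hadd : ∀ i x y, e i (x + y) = e i x + e i y)
    (hcomm : ∀ i j z, e i (e j z) = e j (e i z)) :
    ∃ (A : Type) (_ : CommRing A) (_ : Module A M) (a : I → A), ∀ i z, a i • z = e i z := by
  let f : I → AddMonoid.End M := fun i => AddMonoidHom.mk' (e i) (hadd i)
  have : IsMulCommutative (Subring.closure (Set.range f)) := by
    refine Subring.isMulCommutative_closure ?_
    rintro _ ⟨i, rfl⟩ _ ⟨j, rfl⟩
    ext z
    exact hcomm i j z
  exact ⟨Subring.closure (Set.range f), inferInstance, inferInstance,
    fun i => ⟨f i, Subring.subset_closure ⟨i, rfl⟩⟩, fun _ _ => rfl⟩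

/-- The coefficientwise action of `∂` on `R[λ,μ,γ]`. -/
noncomputable def D3 (D : R →ₗ[ℂ] R) : Pol3 R → Pol3 R :=
  Finsupp.mapRange (Finsupp.mapRange (D1 D) Finsupp.mapRange_zero) Finsupp.mapRange_zero

/-- An `A`-module structure on `R[λ,μ,γ]` in which `l`, `m`, `g`, `d` act as `λ`, `μ`, `γ`, `∂`. -/
structure ActsAs [Module A (Pol3 R)] (D : R →ₗ[ℂ] R) (l m g d : A) : Prop where
  l_smul : ∀ z : Pol3 R, l • z = Xl z
  m_smul : ∀ z : Pol3 R, m • z = Xm z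
  g_smul : ∀ z : Pol3 R, g • z = Xg z
  d_smul : ∀ z : Pol3 R, d • z = D3 D z

omit [Module ℂ R] in
lemma pol3_hom_ext {f g : Pol3 R →+ Pol3 R}
    (h : ∀ i j k r, f (Finsupp.single i (Finsupp.single j (Finsupp.single k r))) =
      g (Finsupp.single i (Finsupp.single j (Finsupp.single k r)))) : f = g := by
  refine Finsupp.addHom_ext' fun i => Finsupp.addHom_ext' fun j => Finsupp.addHom_ext' fun k => ?_
  ext1 r
  exact h i j k r

omit [Module ℂ R] in
lemma Xl_single (i : ℕ) (f : ℕ →₀ ℕ →₀ R) :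
    Xl (Finsupp.single i f) = Finsupp.single (i + 1) f := by
  simp [Xl]

omit [Module ℂ R] in
lemma Xm_single (i j : ℕ) (f : ℕ →₀ R) :
    Xm (Finsupp.single i (Finsupp.single j f)) =
      Finsupp.single i (Finsupp.single (j + 1) f) := by
  simp [Xm]

omit [Module ℂ R] in
lemma Xg_single (i j k : ℕ) (r : R) :
    Xg (Finsupp.single i (Finsupp.single j (Finsupp.single k r))) =
      Finsupp.single i (Finsupp.single j (Finsupp.single (k + 1) r)) := by
  simp [Xg]

lemma D3_single (D : R →ₗ[ℂ] R) (i j k : ℕ) (r : R) :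
    D3 D (Finsupp.single i (Finsupp.single j (Finsupp.single k r))) =
      Finsupp.single i (Finsupp.single j (Finsupp.single k (D r))) := by
  simp [D3, D1]

lemma exists_actsAs (D : R →ₗ[ℂ] R) :
    ∃ (A : Type) (_ : CommRing A) (_ : Module A (Pol3 R)) (l m g d : A), ActsAs D l m g d := by
  let e : Fin 4 → Pol3 R →+ Pol3 R :=
    ![AddMonoidHom.mk' Xl fun _ _ => Finsupp.mapDomain_add,
      AddMonoidHom.mk' Xm (Finsupp.mapRange_add fun _ _ => Finsupp.mapDomain_add),
      AddMonoidHom.mk' Xg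
        (Finsupp.mapRange_add (Finsupp.mapRange_add fun _ _ => Finsupp.mapDomain_add)),
      AddMonoidHom.mk' (D3 D)
        (Finsupp.mapRange_add (Finsupp.mapRange_add (Finsupp.mapRange_add (map_add D))))]
  have h₀ : ∀ z, e 0 z = Xl z := fun _ => rfl
  have h₁ : ∀ z, e 1 z = Xm z := fun _ => rfl
  have h₂ : ∀ z, e 2 z = Xg z := fun _ => rfl
  have h₃ : ∀ z, e 3 z = D3 D z := fun _ => rfl
  clear_value e
  have hcomm : ∀ i j, (e i).comp (e j) = (e j).comp (e i) := by
    intro i j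
    refine pol3_hom_ext fun _ _ _ _ => ?_
    fin_cases i <;> fin_cases j <;>
      simp [h₀, h₁, h₂, h₃, Xl_single, Xm_single, Xg_single, D3_single]
  obtain ⟨A, _, _, a, ha⟩ := exists_commRing_of_commute (fun i => ⇑(e i))
    (fun i => (e i).map_add) (fun i j => DFunLike.congr_fun (hcomm i j))
  exact ⟨A, _, _, a 0, a 1, a 2, a 3, fun z => (ha 0 z).trans (h₀ z),
    fun z => (ha 1 z).trans (h₁ z), fun z => (ha 2 z).trans (h₂ z),
    fun z => (ha 3 z).trans (h₃ z)⟩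

/-- `iota3` as an additive map. -/
noncomputable def iota3Hom : R →+ Pol3 R :=
  AddMonoidHom.mk' iota3 (by intro r s; simp [iota3])

section ActsAs

variable {K : Type} [CommRing K] [Module K (Pol3 R)]

omit [Module ℂ R] in
lemma smul_pow_eq_iterate {t : K} {e : Pol3 R → Pol3 R} (he : ∀ z, t • z = e z) (n : ℕ)
    (z : Pol3 R) : t ^ n • z = e^[n] z := by
  induction n with
  | zero => simp
  | succ n ih => rw [pow_succ', mul_smul, ih, he, Function.iterate_succ_apply']

omit [Module ℂ R] in
lemma ev_eq_evalHom {t : K} {e : Pol3 R → Pol3 R} (he : ∀ z, t • z = e z) (f : Pol1 R) :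
    ev f e = evalHom (N := Pol3 R) t f iota3Hom := by
  simp only [evalHom_apply, ev, smul_pow_eq_iterate he]
  rfl

variable {D : R →ₗ[ℂ] R} {l m g d : K}

lemma ActsAs.intertwines_iota3Hom (h : ActsAs D l m g d) :
    Intertwines (N := Pol3 R) D iota3Hom d := fun r =>
  ((h.d_smul _).trans (D3_single D 0 0 0 r)).symm

lemma ActsAs.lift3_eq_evalHom3 (h : ActsAs D l m g d) (F : R →+ Pol3 R) (w : Pol3 R) :
    lift3 F w = evalHom3 (N := Pol3 R) l m g F w := by
  simp only [evalHom3, lift3, evalHom_apply, AddMonoidHom.flip_apply, Finsupp.smul_sum]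
  simp only [smul_pow_eq_iterate h.l_smul, smul_pow_eq_iterate h.m_smul,
    smul_pow_eq_iterate h.g_smul]

lemma ActsAs.lift3_ev (h : ActsAs D l m g d) {t : K} {e : Pol3 R → Pol3 R}
    (he : ∀ z, t • z = e z)
    (hE : ∀ (F : R →+ Pol3 R) z, evalHom3 (N := Pol3 R) l m g F (e z) =
      t • evalHom3 (N := Pol3 R) l m g F z)
    (F : R →+ Pol3 R) (f : Pol1 R) :
    lift3 F (ev f e) = evalHom (N := Pol3 R) t f F := by
  have hE' : ∀ z : Pol3 R, evalHom3 (N := Pol3 R) l m g F (t • z) =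
      t • evalHom3 (N := Pol3 R) l m g F z := fun z => by rw [he, hE]
  rw [h.lift3_eq_evalHom3, ev_eq_evalHom he]
  refine (map_evalHom (N := Pol3 R) _ hE' f _).trans ?_
  congr 1
  ext1 r
  exact evalHom3_iota3 (N := Pol3 R) l m g F r

lemma ActsAs.lift3_ev_Xl (h : ActsAs D l m g d) (F : R →+ Pol3 R) (f : Pol1 R) :
    lift3 F (ev f Xl) = evalHom (N := Pol3 R) l f F :=
  h.lift3_ev h.l_smul (evalHom3_Xl (N := Pol3 R) _ _ _) F f

lemma ActsAs.lift3_ev_Xm (h : ActsAs D l m g d) (F : R →+ Pol3 R) (f : Pol1 R) :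
    lift3 F (ev f Xm) = evalHom (N := Pol3 R) m f F :=
  h.lift3_ev h.m_smul (evalHom3_Xm (N := Pol3 R) _ _ _) F f

/-- A conformal bilinear map, bundled as a biadditive map. -/
noncomputable def IsConfBilinear.toHom {D : R →ₗ[ℂ] R} {F : R → R → Pol1 R}
    (hF : IsConfBilinear D F) : R →+ R →+ Pol1 R :=
  AddMonoidHom.mk' (fun x => AddMonoidHom.mk' (F x) (hF.add_right x))
    (by intro x y; ext1 z; exact hF.add_left x y z)

lemma evalLeibniz_of_leibniz {B F : R → R → Pol1 R} (hA : ActsAs D l m g d)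
    (hB : IsConfBilinear D B)
    (hF : IsConfBilinear D F)
    (h : ∀ x y z, lift3 (fun r => ev (F x r) Xl) (ev (B y z) Xm)
      = lift3 (fun r => ev (B r z) eLM) (ev (F x y) Xl)
        + lift3 (fun r => ev (B y r) Xm) (ev (F x z) Xl)) :
    EvalLeibniz A N hB.toHom hF.toHom := by
  rintro ι a b _ rfl x y z
  have hLM : ∀ z : Pol3 R, (l + m) • z = eLM z := fun z => by
    rw [add_smul, hA.l_smul, hA.m_smul]; rfl
  have e₁ : (fun r => ev (F x r) Xl) = evalBilin (N := Pol3 R) hF.toHom iota3Hom l x :=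
    funext fun r => ev_eq_evalHom (hA.l_smul) _
  have e₂ : (fun r => ev (B r z) eLM) =
      evalBilinLeft (N := Pol3 R) hB.toHom iota3Hom (l + m) z :=
    funext fun r => ev_eq_evalHom hLM _
  have e₃ : (fun r => ev (B y r) Xm) = evalBilin (N := Pol3 R) hB.toHom iota3Hom m y :=
    funext fun r => ev_eq_evalHom (hA.m_smul) _
  have key := h x y z
  rw [e₁, e₂, e₃, hA.lift3_ev_Xl, hA.lift3_ev_Xl, hA.lift3_ev_Xm] at key
  have key' := congrArg (evalHom3 a b 0 ι) key
  have sL : ∀ w, evalHom3 a b 0 ι (l • w) = a • evalHom3 a b 0 ι w := fun w =>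
    (congrArg (evalHom3 a b 0 ι) (hA.l_smul w)).trans (evalHom3_Xl a b 0 ι w)
  have sM : ∀ w, evalHom3 a b 0 ι (m • w) = b • evalHom3 a b 0 ι w := fun w =>
    (congrArg (evalHom3 a b 0 ι) (hA.m_smul w)).trans (evalHom3_Xm a b 0 ι w)
  have sLM : ∀ w, evalHom3 a b 0 ι ((l + m) • w) = (a + b) • evalHom3 a b 0 ι w := by
    intro w
    rw [add_smul, map_add, sL, sM, add_smul]
  have hι : (evalHom3 a b 0 ι).comp iota3Hom = ι := by
    ext1 r
    exact evalHom3_iota3 a b 0 ι r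
  have c₁ : (evalHom3 a b 0 ι).comp (evalBilin (N := Pol3 R) hF.toHom iota3Hom l x) =
      evalBilin hF.toHom ι a x := by
    ext1 r
    exact (map_evalHom (N := Pol3 R) _ sL (F x r) iota3Hom).trans
      (congrArg (evalHom a (F x r)) hι)
  have c₂ : (evalHom3 a b 0 ι).comp (evalBilinLeft (N := Pol3 R) hB.toHom iota3Hom (l + m) z) =
      (evalBilin hB.toHom ι (a + b)).flip z := by
    ext1 r
    exact (map_evalHom (N := Pol3 R) _ sLM (B r z) iota3Hom).trans
      (congrArg (evalHom (a + b) (B r z)) hι)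
  have c₃ : (evalHom3 a b 0 ι).comp (evalBilin (N := Pol3 R) hB.toHom iota3Hom m y) =
      evalBilin hB.toHom ι b y := by
    ext1 r
    exact (map_evalHom (N := Pol3 R) _ sM (B y r) iota3Hom).trans
      (congrArg (evalHom b (B y r)) hι)
  have k₁ := map_evalHom (N := Pol3 R) _ sM (B y z) (evalBilin (N := Pol3 R) hF.toHom iota3Hom l x)
  have k₂ := map_evalHom (N := Pol3 R) _ sL (F x y)
    (evalBilinLeft (N := Pol3 R) hB.toHom iota3Hom (l + m) z)
  have k₃ := map_evalHom (N := Pol3 R) _ sL (F x z) (evalBilin (N := Pol3 R) hB.toHom iota3Hom m y)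
  rw [c₁] at k₁
  rw [c₂] at k₂
  rw [c₃] at k₃
  exact k₁.symm.trans (key'.trans ((map_add _ _ _).trans (congrArg₂ (· + ·) k₂ k₃)))

lemma lift3_lift3_ev {B : R → R → Pol1 R} (hA : ActsAs D l m g d)
    (hB : IsConfBilinear D B) (p q : Pol1 R) :
    lift3 (fun r => lift3 (fun s => ev (B r s) eMG) (ev q Xl)) (ev p Xm) =
      evalHom (N := Pol3 R) m p
        ((evalHom l q).comp (evalBilin (N := Pol3 R) hB.toHom iota3Hom (m + g))) := by
  have hMG : ∀ z : Pol3 R, (m + g) • z = eMG z := fun z => by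
    rw [add_smul, hA.m_smul, hA.g_smul]; rfl
  rw [← hA.lift3_ev_Xm]
  congr 1
  ext1 r
  have e : (fun s => ev (B r s) eMG) = evalBilin (N := Pol3 R) hB.toHom iota3Hom (m + g) r :=
    funext fun s => ev_eq_evalHom hMG _
  rw [e]
  exact hA.lift3_ev_Xl _ q

end ActsAs

end Polynomials

lemma eq_zero_of_eq_neg_self {M : Type} [AddCommGroup M] [Module ℂ M] {z : M} (hz : z = -z) :
    z = 0 := by
  have h : (2 : ℂ) • z = 0 := (two_smul ℂ z).trans (add_eq_zero_iff_eq_neg.mpr hz)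
  exact (smul_eq_zero.mp h).resolve_left two_ne_zero

/-- for a conformal biderivation `φ` of a Lie conformal algebra `R`,
`[(φ_μ(x,y))_{μ+γ} [u_λ v]] = [[x_μ y]_{μ+γ} φ_λ(u,v)]` for all `x, y, u, v ∈ R`. -/
theorem biderivation_lem2 {R : Type} [AddCommGroup R] [Module ℂ R]
    (D : R →ₗ[ℂ] R) (B : R → R → Pol1 R) (hR : IsLieConformal D B)
    (φ : R → R → Pol1 R) (hφ : IsConfBiderivation D B φ) :
    ∀ x y u v : R,
      lift3 (fun r => lift3 (fun s => ev (B r s) eMG) (ev (B u v) Xl)) (ev (φ x y) Xm)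
        = lift3 (fun r => lift3 (fun s => ev (B r s) eMG) (ev (φ u v) Xl))
            (ev (B x y) Xm) := by
  intro x y u v
  obtain ⟨A, _, _, l, m, g, d, hA⟩ := exists_actsAs D
  rw [lift3_lift3_ev hA hR.bilin, lift3_lift3_ev hA hR.bilin]
  refine sub_eq_zero.mp (defect_eq_zero (B := hR.bilin.toHom) (φ := hφ.bilin.toHom) ?_ hR.bilin
    hR.skew hφ.skew (evalLeibniz_of_leibniz hA hR.bilin hR.bilin hR.jacobi)
    (evalLeibniz_of_leibniz hA hR.bilin hφ.bilin hφ.leibniz) hA.intertwines_iota3Hom v x m y g u l)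
  exact fun z => eq_zero_of_eq_neg_self (M := Pol3 R)

end ConfBider
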